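/- arXiv:2306.06011 — 4 statements merged into one kernel-verified Lean document; each statement's English description precedes it below -/
import Mathlib

section
/- Let k be a field, let f(x) = f_n x^n + … + f_1 x + f_0 ∈ k[x] be a separable polynomial of degree n with f_n ≠ 0, let L = k[x]/(f) = k[θ], and fix a unit ξ ∈ L^×. Let 𝐆 be the n×n matrix with (i,j) entry Tr_{L/k}(f_n ξ θ^{i+j}/f'(θ)) (indices 0 ≤ i,j ≤ n−1) and 𝐇 = 𝐆Θ where Θ is the matrix of multiplication by θ in the power basis. Then det(x𝐆 − 𝐇) = (−1)^{n(n−1)/2} f_n^{−1} N_{L/k}(ξ) f(x) as polynomials in k[x]. -/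
open Polynomial Matrix

lemma aux_vand {E : Type*} [Field E] (n : ℕ) (α : Fin n → E) :
    (vandermonde α).det ^ 2
      = (-1) ^ (n * (n - 1) / 2) * ∏ a, ∏ b ∈ {a}ᶜ, (α a - α b) := by
  have h1 : ∏ a, ∏ b ∈ ({a} : Finset (Fin n))ᶜ, (α a - α b)
      = ∏ i, ∏ j ∈ Finset.Ioi i, (α i - α j) * (α j - α i) :=
    (Finset.prod_prod_Ioi_mul_eq_prod_prod_off_diag (fun j i => α i - α j)).symm
  have h2 : ((-1 : E)) ^ (n * (n - 1) / 2) = ∏ i : Fin n, ∏ j ∈ Finset.Ioi i, (-1 : E) := by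
    simp only [Finset.prod_const, Finset.prod_pow_eq_pow_sum, Fin.card_Ioi]
    congr 1
    rw [← Finset.sum_range_id, ← Finset.sum_range_reflect, Finset.sum_range]
  rw [h1, h2, det_vandermonde, ← Finset.prod_pow, ← Finset.prod_mul_distrib]
  refine Finset.prod_congr rfl fun i _ => ?_
  rw [← Finset.prod_pow, ← Finset.prod_mul_distrib]
  refine Finset.prod_congr rfl fun j _ => ?_
  ring

lemma aux_roots {k E : Type*} [Field k] [Field E] [Algebra k E] (n : ℕ) (f : k[X])
    (hn : f.natDegree = n) (hsep : f.Separable)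
    (hs : (f.map (algebraMap k E)).Splits) :
    ∃ α : Fin n → E, Function.Injective α ∧
      f.map (algebraMap k E) = C (algebraMap k E f.leadingCoeff) * ∏ a, (X - C (α a)) := by
  classical
  set g := f.map (algebraMap k E) with hg
  have hnd : g.roots.Nodup := nodup_roots hsep.map
  have hcard : g.roots.toFinset.card = n := by
    rw [Multiset.toFinset_card_of_nodup hnd, ← hs.natDegree_eq_card_roots, hg, natDegree_map, hn]
  let e := (g.roots.toFinset.equivFinOfCardEq hcard).symm
  refine ⟨fun a => (e a : E), Subtype.val_injective.comp e.injective, ?_⟩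
  refine hs.eq_prod_roots.trans ?_
  have hl : g.leadingCoeff = algebraMap k E f.leadingCoeff := leadingCoeff_map _
  rw [hl]
  congr 1
  rw [e.prod_comp (fun r => X - C (r : E)), Finset.prod_coe_sort _ (fun r => X - C (r : E)),
    Finset.prod, Multiset.toFinset_val, hnd.dedup]

lemma aux_deriv {k E : Type*} [Field k] [Field E] [Algebra k E] (n : ℕ) (f : k[X])
    (α : Fin n → E) 
    (hf : f.map (algebraMap k E) = C (algebraMap k E f.leadingCoeff) * ∏ a, (X - C (α a)))
    (a : Fin n) :
    aeval (α a) (derivative f) = algebraMap k E f.leadingCoeff * ∏ b ∈ {a}ᶜ, (α a - α b) := by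
  classical
  rw [← eval_map_algebraMap, ← derivative_map, hf, derivative_C_mul, eval_C_mul]
  congr 1
  have : ∏ b, (X - C (α b)) = (X - C (α a)) * ∏ b ∈ {a}ᶜ, (X - C (α b)) := by
    exact Fintype.prod_eq_mul_prod_compl a (fun b => X - C (α b))
  rw [this, derivative_mul]
  simp [eval_prod]

lemma aux_diag {k E L : Type*} [Field k] [Field E] [CommRing L] [Algebra k L] [Algebra k E] (n : ℕ)
    (b : Module.Basis (Fin n) k L) (θ : L) (hb : ∀ i, b i = θ ^ (i : ℕ))
    (α : Fin n → E) (φ : Fin n → L →ₐ[k] E) (hφ : ∀ a, φ a θ = α a) (y : L) :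
    diagonal (fun a => φ a y) * vandermonde α
      = vandermonde α * (Algebra.leftMulMatrix b y).map (algebraMap k E) := by
  ext a j
  rw [diagonal_mul, mul_apply]
  have := congrArg (φ a) (b.sum_repr (y * b j))
  simp only [map_sum, map_smul, map_mul, hb, map_pow, hφ] at this
  simp only [vandermonde_apply, map_apply, Algebra.leftMulMatrix_eq_repr_mul, hb]
  rw [← this]
  refine Finset.sum_congr rfl fun i _ => ?_
  rw [Algebra.smul_def, mul_comm]

lemma aux_trace {k E L : Type*} [Field k] [Field E] [CommRing L] [Algebra k L] [Algebra k E] (n : ℕ)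
    (b : Module.Basis (Fin n) k L) (θ : L) (hb : ∀ i, b i = θ ^ (i : ℕ))
    (α : Fin n → E) (hα : Function.Injective α)
    (φ : Fin n → L →ₐ[k] E) (hφ : ∀ a, φ a θ = α a) (y : L) :
    algebraMap k E (Algebra.trace k L y) = ∑ a, φ a y := by
  have h := aux_diag n b θ hb α φ hφ y
  have hu : IsUnit (vandermonde α).det := (det_vandermonde_ne_zero_iff.2 hα).isUnit
  have h2 : (Algebra.leftMulMatrix b y).map (algebraMap k E)
      = (vandermonde α)⁻¹ * (diagonal (fun a => φ a y) * vandermonde α) := by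
    rw [h, nonsing_inv_mul_cancel_left _ _ hu]
  rw [Algebra.trace_eq_matrix_trace b]
  refine (AddMonoidHom.map_trace (algebraMap k E).toAddMonoidHom _).trans ?_
  change trace ((Algebra.leftMulMatrix b y).map (algebraMap k E)) = _
  rw [h2, trace_mul_comm, mul_nonsing_inv_cancel_right _ _ hu, trace_diagonal]

lemma aux_norm {k E L : Type*} [Field k] [Field E] [CommRing L] [Algebra k L] [Algebra k E] (n : ℕ)
    (b : Module.Basis (Fin n) k L) (θ : L) (hb : ∀ i, b i = θ ^ (i : ℕ))
    (α : Fin n → E) (hα : Function.Injective α)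
    (φ : Fin n → L →ₐ[k] E) (hφ : ∀ a, φ a θ = α a) (y : L) :
    algebraMap k E (Algebra.norm k y) = ∏ a, φ a y := by
  have h := congrArg det (aux_diag n b θ hb α φ hφ y)
  have hu : (vandermonde α).det ≠ 0 := det_vandermonde_ne_zero_iff.2 hα
  rw [det_mul, det_mul, det_diagonal, mul_comm] at h
  rw [Algebra.norm_eq_matrix_det b, mul_left_cancel₀ hu h]
  exact (algebraMap k E).map_det _


/-- Proposition 2.5(ii): `det(x𝐆 − 𝐇) = (−1)^{n(n−1)/2} f_n⁻¹ N_{L/k}(ξ) f(x)`. -/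
theorem stmt_1 (k : Type*) [Field k] (n : ℕ) (f : k[X])
    (hdeg : f.degree = n) (hsep : f.Separable)
    (ξ : (AdjoinRoot f)ˣ) (d : AdjoinRoot f)
    (hd : aeval (AdjoinRoot.root f) (derivative f) * d = 1)
    (G : Matrix (Fin n) (Fin n) k)
    (hG : ∀ i j : Fin n, G i j =
      Algebra.trace k (AdjoinRoot f)
        (f.leadingCoeff • ((ξ : AdjoinRoot f) * AdjoinRoot.root f ^ ((i : ℕ) + (j : ℕ)) * d)))
    (Θ : Matrix (Fin n) (Fin n) k)
    (hΘ : ∀ j : Fin n, AdjoinRoot.root f ^ ((j : ℕ) + 1)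
        = ∑ i : Fin n, algebraMap k (AdjoinRoot f) (Θ i j) * AdjoinRoot.root f ^ (i : ℕ))
    (H : Matrix (Fin n) (Fin n) k) (hH : H = G * Θ) :
    Matrix.det ((X : k[X]) • G.map C - H.map C)
      = (-1) ^ (n * (n - 1) / 2)
        * C (f.leadingCoeff⁻¹ * Algebra.norm k (ξ : AdjoinRoot f)) * f := by
  classical
  have hn : f.natDegree = n := natDegree_eq_of_degree_eq_some hdeg
  have hf0 : f ≠ 0 := by rintro rfl; simp at hdeg
  let E := AlgebraicClosure k
  have hs : (f.map (algebraMap k E)).Splits := IsAlgClosed.splits _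
  obtain ⟨α, hα, hf⟩ := aux_roots (E := E) n f hn hsep hs
  have hroot : ∀ a, aeval (α a) f = 0 := by
    intro a
    rw [← eval_map_algebraMap, hf, eval_mul, eval_prod, Finset.prod_eq_zero (Finset.mem_univ a),
      mul_zero]
    simp
  let φ : Fin n → AdjoinRoot f →ₐ[k] E := fun a =>
    AdjoinRoot.liftAlgHom f (Algebra.ofId k E) (α a) (hroot a)
  have hφ : ∀ a, φ a (AdjoinRoot.root f) = α a := fun a => AdjoinRoot.liftAlgHom_root _ _ _ _
  let b : Module.Basis (Fin n) k (AdjoinRoot f) :=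
    (AdjoinRoot.powerBasis hf0).basis.reindex (finCongr hn)
  have hb : ∀ i, b i = AdjoinRoot.root f ^ (i : ℕ) := by
    intro i
    simp [b]
    rfl
  set c : E := algebraMap k E f.leadingCoeff with hc
  have hc0 : c ≠ 0 := by simpa [hc] using hf0
  let V := vandermonde α
  let w : Fin n → E := fun a => c * (φ a ξ * φ a d)
  have hGE : G.map (algebraMap k E) = Vᵀ * (diagonal w * V) := by
    ext i j
    rw [map_apply, hG, aux_trace n b _ hb α hα φ hφ, mul_apply]
    refine Finset.sum_congr rfl fun a _ => ?_
    rw [diagonal_mul, map_smul, map_mul, map_mul, map_pow, hφ, Algebra.smul_def]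
    simp only [V, w, transpose_apply, vandermonde_apply, pow_add]
    ring
  have hΘE : V * Θ.map (algebraMap k E) = diagonal α * V := by
    ext a j
    have := congrArg (φ a) (hΘ j)
    simp only [map_sum, map_mul, map_pow, hφ, AlgHom.commutes] at this
    rw [diagonal_mul, mul_apply]
    simp only [V, vandermonde_apply, map_apply]
    rw [← pow_succ', this]
    exact Finset.sum_congr rfl fun i _ => mul_comm _ _
  have hHE : H.map (algebraMap k E) = Vᵀ * (diagonal w * (diagonal α * V)) := by
    rw [hH, Matrix.map_mul, hGE, ← hΘE]
    simp only [Matrix.mul_assoc]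
  have hM : ((X : k[X]) • G.map C - H.map C).map (Polynomial.mapRingHom (algebraMap k E))
      = (V.map C)ᵀ * (diagonal (fun a => C (w a) * (X - C (α a))) * V.map C) := by
    have e1 : ((X : k[X]) • G.map C - H.map C).map (Polynomial.mapRingHom (algebraMap k E))
      = (X : E[X]) • (G.map (algebraMap k E)).map C - (H.map (algebraMap k E)).map C := by
      ext1 i j
      simp
    rw [e1, hGE, hHE]
    simp only [Matrix.map_mul, diagonal_map, map_zero]
    have e2 : diagonal (fun a => C (w a) * (X - C (α a)))
        = (X : E[X]) • diagonal (fun a => C (w a))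
          - diagonal (fun a => C (w a)) * diagonal (fun a => C (α a)) := by
      rw [diagonal_mul_diagonal, ← diagonal_smul, diagonal_sub]
      congr 1
      ext1 a
      simp only [Pi.smul_apply, smul_eq_mul]
      ring
    rw [e2]
    simp only [Matrix.sub_mul, Matrix.mul_sub, Matrix.smul_mul, Matrix.mul_smul, Matrix.mul_assoc,
      transpose_map]
  have hdet : (V.map (C : E →+* E[X])).det = C V.det := (RingHom.map_det C V).symm
  apply Polynomial.map_injective (algebraMap k E) (algebraMap k E).injective
  have hL : (Matrix.det ((X : k[X]) • G.map C - H.map C)).map (algebraMap k E)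
      = C (V.det ^ 2 * ∏ a, w a) * ∏ a, (X - C (α a)) := by
    rw [← coe_mapRingHom, RingHom.map_det]
    change det (((X : k[X]) • G.map C - H.map C).map (Polynomial.mapRingHom (algebraMap k E))) = _
    rw [hM, det_mul, det_mul, det_transpose, det_diagonal, hdet, Finset.prod_mul_distrib, C_mul,
      C_pow, map_prod]
    ring
  have hN := aux_norm n b _ hb α hα φ hφ (ξ : AdjoinRoot f)
  have hdd : ∀ a, c * (∏ b ∈ {a}ᶜ, (α a - α b)) * φ a d = 1 := by
    intro a
    have := congrArg (φ a) hd
    rwa [map_mul, map_one, ← aeval_algHom_apply, hφ, aux_deriv n f α hf a] at this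
  have hw : V.det ^ 2 * ∏ a, w a
      = (-1) ^ (n * (n - 1) / 2) * algebraMap k E (Algebra.norm k (ξ : AdjoinRoot f)) := by
    rw [hN, aux_vand, mul_assoc, ← Finset.prod_mul_distrib]
    congr 1
    refine Finset.prod_congr rfl fun a _ => ?_
    linear_combination (φ a ξ) * hdd a
  rw [hL, hw, Polynomial.map_mul, Polynomial.map_mul, hf, map_C, map_mul (algebraMap k E), map_inv₀, ← hc]
  have : (C c⁻¹ : E[X]) * C c = 1 := by rw [← C_mul, inv_mul_cancel₀ hc0, C_1]
  simp only [C_mul, C_pow, C_neg, C_1, Polynomial.map_pow, Polynomial.map_neg, Polynomial.map_one]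
  linear_combination (-(-1) ^ (n * (n - 1) / 2)
    * C (algebraMap k E (Algebra.norm k (ξ : AdjoinRoot f))) * ∏ a, (X - C (α a))) * this
end

section
/- Let R be a commutative ring, let f₆, θ₁, …, θ₆ ∈ R, and let f₀, …, f₅ ∈ R be the coefficients determined by f₆·∏_{i=1}^{6}(x−θᵢ) = f₆x⁶+f₅x⁵+f₄x⁴+f₃x³+f₂x²+f₁x+f₀. Write Aᵢ = A(θᵢ). Then A₁* A₂ A₃* A₄ A₅* A₆ = f₆³ · ∏_{1 ≤ i < j ≤ 6}(θᵢ − θⱼ) · I₄. -/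
open Matrix Polynomial

/-- For a `4×4` skew-symmetric matrix `A = (A_{ij})`, the matrix `A*`. -/
def starMat {R : Type*} [CommRing R] (A : Matrix (Fin 4) (Fin 4) R) :
    Matrix (Fin 4) (Fin 4) R :=
  !![0, A 3 2, A 1 3, A 2 1;
     A 2 3, 0, A 3 0, A 0 2;
     A 3 1, A 0 3, 0, A 1 0;
     A 1 2, A 2 0, A 0 1, 0]

/-- The skew-symmetric matrix `A(θ)` of (2.9). -/
def Amat {R : Type*} [CommRing R] (f1 f2 f3 f4 f5 f6 θ : R) :
    Matrix (Fin 4) (Fin 4) R :=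
  let h3 := 2 * f6 * θ ^ 3 + f5 * θ ^ 2
  let h4 := 2 * f6 * θ ^ 4 + 2 * f5 * θ ^ 3 + 2 * f4 * θ ^ 2 + f3 * θ
  let h5 := 2 * f6 * θ ^ 5 + 2 * f5 * θ ^ 4 + 2 * f4 * θ ^ 3 + 2 * f3 * θ ^ 2
      + 2 * f2 * θ + f1
  !![0, h5, h4, θ ^ 2;
     -h5, 0, h3, -θ;
     -h4, -h3, 0, 1;
     -θ ^ 2, θ, -1, 0]

/-- The symmetric matrix with `A₁* A₂ A₃* = V(θ₁,θ₂,θ₃) • S`, where `a b c` are the coefficients of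
the monic cubic with roots `θ₁, θ₂, θ₃` and `p q r` those of the complementary cubic. -/
def Smat {R : Type*} [CommRing R] (a b c p q r F : R) : Matrix (Fin 4) (Fin 4) R :=
    !![a * F - p * F, -b * F + q * F, c * F - r * F, -a * c * p * F^2 - a^2 * r * F^2 + c * p^2
      * F^2 - 2 * c * q * F^2 + 2 * b * r * F^2 + a * p * r * F^2;
         -b * F + q * F, c * F + b * p * F - a * q * F - r * F, -c * p * F + a * r * F, -c^2 *
      F^2 + b * c * p * F^2 + a * c * q * F^2 - b * p * r * F^2 - a * q * r * F^2 + r^2 * F^2;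
         c * F - r * F, -c * p * F + a * r * F, c * q * F - b * r * F, -b * c * q * F^2 + b^2 *
      r * F^2 - 2 * a * c * r * F^2 + 2 * c * p * r * F^2 - c * q^2 * F^2 + b * q * r * F^2;
         -a * c * p * F^2 - a^2 * r * F^2 + c * p^2 * F^2 - 2 * c * q * F^2 + 2 * b * r * F^2 +
      a * p * r * F^2, -c^2 * F^2 + b * c * p * F^2 + a * c * q * F^2 - b * p * r * F^2 - a * q
      * r * F^2 + r^2 * F^2, -b * c * q * F^2 + b^2 * r * F^2 - 2 * a * c * r * F^2 + 2 * c * p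
      * r * F^2 - c * q^2 * F^2 + b * q * r * F^2, a * c^2 * q * F^3 + a * b * c * p * q * F^3
      - a * b * c * r * F^3 - a * b^2 * p * r * F^3 + 4 * a^2 * c * p * r * F^3 - a^2 * c * q^2
      * F^3 + a^2 * b * q * r * F^3 - c^2 * p * q * F^3 + 4 * c^2 * r * F^3 - b * c * p^2 * q *
      F^3 - 3 * b * c * p * r * F^3 + 4 * b * c * q^2 * F^3 + b^2 * p^2 * r * F^3 - 4 * b^2 * q
      * r * F^3 - 4 * a * c * p^2 * r * F^3 + a * c * p * q^2 * F^3 + 3 * a * c * q * r * F^3 -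
      a * b * p * q * r * F^3 + a * b * r^2 * F^3 + c * p * q * r * F^3 - 4 * c * r^2 * F^3 - b
      * p * r^2 * F^3]

/-- The symmetric matrix with `A₁ A₂* A₃ = V(θ₁,θ₂,θ₃) • T`. -/
def Tmat {R : Type*} [CommRing R] (a b c p q r F : R) : Matrix (Fin 4) (Fin 4) R :=
    !![c^2 * q * F^2 + b * c * p * q * F^2 - b * c * r * F^2 - b^2 * p * r * F^2 + 4 * a * c *
      p * r * F^2 - a * c * q^2 * F^2 + a * b * q * r * F^2 - c * q * r * F^2 + b * r^2 * F^2,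
      b * c * q * F^2 - b^2 * r * F^2 + 2 * a * c * r * F^2 + 2 * c * p * r * F^2 - c * q^2 *
      F^2 + b * q * r * F^2, -c^2 * F^2 + b * c * p * F^2 + a * c * q * F^2 + 2 * c * r * F^2 +
      b * p * r * F^2 + a * q * r * F^2 - r^2 * F^2, c * p * F + a * r * F;
         b * c * q * F^2 - b^2 * r * F^2 + 2 * a * c * r * F^2 + 2 * c * p * r * F^2 - c * q^2
      * F^2 + b * q * r * F^2, a * c * q * F^2 - a * b * r * F^2 - c * p * q * F^2 + 4 * c * r
      * F^2 + b * p * r * F^2, a * c * p * F^2 - a^2 * r * F^2 - c * p^2 * F^2 + 2 * c * q *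
      F^2 + 2 * b * r * F^2 + a * p * r * F^2, c * F + r * F;
         -c^2 * F^2 + b * c * p * F^2 + a * c * q * F^2 + 2 * c * r * F^2 + b * p * r * F^2 + a
      * q * r * F^2 - r^2 * F^2, a * c * p * F^2 - a^2 * r * F^2 - c * p^2 * F^2 + 2 * c * q *
      F^2 + 2 * b * r * F^2 + a * p * r * F^2, a * c * F^2 + a * b * p * F^2 - a^2 * q * F^2 -
      c * p * F^2 - b * p^2 * F^2 + 4 * b * q * F^2 + a * p * q * F^2 - a * r * F^2 + p * r *
      F^2, b * F + q * F;
         c * p * F + a * r * F, c * F + r * F, b * F + q * F, 1]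

set_option maxHeartbeats 4000000 in
theorem tripleS {R : Type*} [CommRing R] (F p q r x y z a b c : R)
    (ha : a = -(x + y + z)) (hb : b = x * y + x * z + y * z) (hc : c = -(x * y * z)) :
    let A := Amat (F * ((b * r) + (c * q))) (F * (c * p + b * q + a * r)) (F * (c + b * p + a * q + r)) (F * (b + a * p + q)) (F * (a + p)) F
    starMat (A x) * A y * starMat (A z) = ((x - y) * (x - z) * (y - z)) • Smat a b c p q r F := by
  intro A
  subst ha hb hc
  ext i j
  fin_cases i <;> fin_cases j <;>
    simp [A, Amat, starMat, Smat, Matrix.mul_apply, Fin.sum_univ_four] <;> ring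

set_option maxHeartbeats 4000000 in
theorem tripleT {R : Type*} [CommRing R] (F p q r x y z a b c : R)
    (ha : a = -(x + y + z)) (hb : b = x * y + x * z + y * z) (hc : c = -(x * y * z)) :
    let A := Amat (F * ((b * r) + (c * q))) (F * (c * p + b * q + a * r)) (F * (c + b * p + a * q + r)) (F * (b + a * p + q)) (F * (a + p)) F
    A x * starMat (A y) * A z = ((x - y) * (x - z) * (y - z)) • Tmat a b c p q r F := by
  intro A
  subst ha hb hc
  ext i j
  fin_cases i <;> fin_cases j <;>
    simp [A, Amat, starMat, Tmat, Matrix.mul_apply, Fin.sum_univ_four] <;> ring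

/-- The resultant of the two monic cubics. -/
def resCub {R : Type*} [CommRing R] (a b c p q r : R) : R :=
  (Smat a b c p q r 1 * Tmat p q r a b c 1) 0 0

set_option maxHeartbeats 4000000 in
theorem smat_mul_tmat {R : Type*} [CommRing R] (a b c p q r F : R) :
    Smat a b c p q r F * Tmat p q r a b c F = (F ^ 3 * resCub a b c p q r) • 1 := by
  ext i j
  fin_cases i <;> fin_cases j <;>
    simp [resCub, Smat, Tmat, Matrix.mul_apply, Fin.sum_univ_four] <;> ring

set_option maxHeartbeats 4000000 in
theorem res_eval {R : Type*} [CommRing R] (p q r x y z : R) :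
    resCub (-(x + y + z)) (x * y + x * z + y * z) (-(x * y * z)) p q r
      = (x^3 + p * x^2 + q * x + r) * (y^3 + p * y^2 + q * y + r)
        * (z^3 + p * z^2 + q * z + r) := by
  simp [resCub, Smat, Tmat, Matrix.mul_apply, Fin.sum_univ_four]
  ring

theorem coeffs {R : Type*} [CommRing R] (f0 f1 f2 f3 f4 f5 F a b c p q r : R)
    (h : C F * ((X ^ 3 + C a * X ^ 2 + C b * X + C c) * (X ^ 3 + C p * X ^ 2 + C q * X + C r))
      = C F * X ^ 6 + C f5 * X ^ 5 + C f4 * X ^ 4 + C f3 * X ^ 3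
        + C f2 * X ^ 2 + C f1 * X + C f0) :
    f1 = F * ((b * r) + (c * q)) ∧ f2 = F * (c * p + b * q + a * r) ∧
    f3 = F * (c + b * p + a * q + r) ∧ f4 = F * (b + a * p + q) ∧ f5 = F * (a + p) := by
  have h' : C F * X ^ 6 + C (F * (a + p)) * X ^ 5 + C (F * (b + a * p + q)) * X ^ 4
      + C (F * (c + b * p + a * q + r)) * X ^ 3 + C (F * (c * p + b * q + a * r)) * X ^ 2
      + C (F * ((b * r) + (c * q))) * X + C (F * (c * r))
      = C F * X ^ 6 + C f5 * X ^ 5 + C f4 * X ^ 4 + C f3 * X ^ 3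
        + C f2 * X ^ 2 + C f1 * X + C f0 := by
    rw [← h]
    simp only [C_mul, C_add]
    ring
  have k := fun n => congrArg (fun P => coeff P n) h'
  refine ⟨?_, ?_, ?_, ?_, ?_⟩
  · simpa [coeff_X, coeff_C, coeff_X_pow, -map_mul, -map_add] using (k 1).symm
  · simpa [coeff_X, coeff_C, coeff_X_pow, -map_mul, -map_add] using (k 2).symm
  · simpa [coeff_X, coeff_C, coeff_X_pow, -map_mul, -map_add] using (k 3).symm
  · simpa [coeff_X, coeff_C, coeff_X_pow, -map_mul, -map_add] using (k 4).symm
  · simpa [coeff_X, coeff_C, coeff_X_pow, -map_mul, -map_add] using (k 5).symm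

/-- Equation (2.14): `A₁* A₂ A₃* A₄ A₅* A₆ = f₆³ ∏_{i<j}(θᵢ − θⱼ) · I₄`. -/
theorem stmt_6 (R : Type*) [CommRing R] (f0 f1 f2 f3 f4 f5 f6 : R) (θ : Fin 6 → R)
    (hf : C f6 * ∏ i : Fin 6, (X - C (θ i))
      = C f6 * X ^ 6 + C f5 * X ^ 5 + C f4 * X ^ 4 + C f3 * X ^ 3
        + C f2 * X ^ 2 + C f1 * X + C f0) :
    starMat (Amat f1 f2 f3 f4 f5 f6 (θ 0)) * Amat f1 f2 f3 f4 f5 f6 (θ 1)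
      * starMat (Amat f1 f2 f3 f4 f5 f6 (θ 2)) * Amat f1 f2 f3 f4 f5 f6 (θ 3)
      * starMat (Amat f1 f2 f3 f4 f5 f6 (θ 4)) * Amat f1 f2 f3 f4 f5 f6 (θ 5)
    = (f6 ^ 3 * ∏ i : Fin 6, ∏ j ∈ Finset.Ioi i, (θ i - θ j))
        • (1 : Matrix (Fin 4) (Fin 4) R) := by
  obtain ⟨x, hx⟩ : ∃ x, x = θ 0 := ⟨_, rfl⟩
  obtain ⟨y, hy⟩ : ∃ x, x = θ 1 := ⟨_, rfl⟩
  obtain ⟨z, hz⟩ : ∃ x, x = θ 2 := ⟨_, rfl⟩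
  obtain ⟨u, hu⟩ : ∃ x, x = θ 3 := ⟨_, rfl⟩
  obtain ⟨v, hv⟩ : ∃ x, x = θ 4 := ⟨_, rfl⟩
  obtain ⟨w, hw⟩ : ∃ x, x = θ 5 := ⟨_, rfl⟩
  have hprod : ∏ i : Fin 6, ∏ j ∈ Finset.Ioi i, (θ i - θ j)
      = ((x - y) * (x - z) * (y - z)) * ((u - v) * (u - w) * (v - w))
        * ((x - u) * (x - v) * (x - w) * ((y - u) * (y - v) * (y - w))
          * ((z - u) * (z - v) * (z - w))) := by
    have e0 : Finset.Ioi (0 : Fin 6) = {1, 2, 3, 4, 5} := by decide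
    have e1 : Finset.Ioi (1 : Fin 6) = {2, 3, 4, 5} := by decide
    have e2 : Finset.Ioi (2 : Fin 6) = {3, 4, 5} := by decide
    have e3 : Finset.Ioi (3 : Fin 6) = {4, 5} := by decide
    have e4 : Finset.Ioi (4 : Fin 6) = {5} := by decide
    have e5 : Finset.Ioi (5 : Fin 6) = ∅ := by decide
    rw [Fin.prod_univ_six, e0, e1, e2, e3, e4, e5]
    simp [← hx, ← hy, ← hz, ← hu, ← hv, ← hw]
    ac_rfl
  rw [hprod]
  rw [Fin.prod_univ_six] at hf
  rw [← hx, ← hy, ← hz, ← hu, ← hv, ← hw] at hf ⊢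
  obtain ⟨a, ha⟩ : ∃ a, a = -(x + y + z) := ⟨_, rfl⟩
  obtain ⟨b, hb⟩ : ∃ b, b = x * y + x * z + y * z := ⟨_, rfl⟩
  obtain ⟨c, hc⟩ : ∃ c, c = -(x * y * z) := ⟨_, rfl⟩
  obtain ⟨p, hp⟩ : ∃ a, a = -(u + v + w) := ⟨_, rfl⟩
  obtain ⟨q, hq⟩ : ∃ b, b = u * v + u * w + v * w := ⟨_, rfl⟩
  obtain ⟨r, hr⟩ : ∃ c, c = -(u * v * w) := ⟨_, rfl⟩
  obtain ⟨h1, h2, h3, h4, h5⟩ := coeffs f0 f1 f2 f3 f4 f5 f6 a b c p q r (by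
    rw [← hf, ha, hb, hc, hp, hq, hr]
    simp only [C_mul, C_add, C_neg]
    ring)
  have hS := tripleS f6 p q r x y z a b c ha hb hc
  have hT := tripleT f6 a b c u v w p q r hp hq hr
  have g1 : f6 * ((q * c) + (r * b)) = f1 := by rw [h1]; ring
  have g2 : f6 * (r * a + q * b + p * c) = f2 := by rw [h2]; ring
  have g3 : f6 * (r + q * a + p * b + c) = f3 := by rw [h3]; ring
  have g4 : f6 * (q + p * a + b) = f4 := by rw [h4]; ring
  have g5 : f6 * (p + a) = f5 := by rw [h5]; ring
  simp only [← h1, ← h2, ← h3, ← h4, ← h5] at hS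
  simp only [g1, g2, g3, g4, g5] at hT
  have hres : resCub a b c p q r = (x - u) * (x - v) * (x - w) * ((y - u) * (y - v) * (y - w))
          * ((z - u) * (z - v) * (z - w)) := by
    rw [ha, hb, hc, res_eval, hp, hq, hr]
    ring
  rw [hS, Matrix.mul_assoc, Matrix.mul_assoc, ← Matrix.mul_assoc (Amat _ _ _ _ _ _ u), hT,
    Matrix.smul_mul, Matrix.mul_smul, smat_mul_tmat, hres, smul_smul, smul_smul]
  congr 1
  generalize (x - y) * (x - z) * (y - z) = V1
  generalize (u - v) * (u - w) * (v - w) = V2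
  generalize (x - u) * (x - v) * (x - w) * ((y - u) * (y - v) * (y - w))
    * ((z - u) * (z - v) * (z - w)) = V3
  ring
end

section
/- Let k be an algebraically closed field of characteristic ≠ 2 and let V be the 5-dimensional space of quartic forms in k[x₁,x₂,x₃,x₄] invariant under the standard level-2 Heisenberg group H₂. Up to scalar multiple, there are exactly 10 nonzero quartic forms in V that factor as the square of a quadratic form; they are the squares of the quadratic forms x₁² + u x₂² + v x₃² + uv x₄² (u, v ∈ {±1}), x₁x₂ + u x₃x₄, x₁x₃ + u x₂x₄, and x₁x₄ + u x₂x₃ (u ∈ {±1}), i.e. the squares of the quadratic forms corresponding to the symmetric matrices in the image of H₂ in PGL₄. -/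
open Matrix MvPolynomial

noncomputable section

/-- The four generators of the standard level-2 Heisenberg group `H₂ ⊂ GL₄`. -/
def heisGens (k : Type*) [Field k] : Set (Matrix (Fin 4) (Fin 4) k) :=
  {Matrix.diagonal ![1, -1, 1, -1], Matrix.diagonal ![1, 1, -1, -1],
   !![0, 1, 0, 0; 1, 0, 0, 0; 0, 0, 0, 1; 0, 0, 1, 0],
   !![0, 0, 1, 0; 0, 0, 0, 1; 1, 0, 0, 0; 0, 1, 0, 0]}

/-- The substitution action `F ↦ F(Mx)` of a matrix on polynomials in
`x₁,…,x₄ = X 0,…,X 3`. -/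
def matAct {k : Type*} [Field k] (M : Matrix (Fin 4) (Fin 4) k)
    (F : MvPolynomial (Fin 4) k) : MvPolynomial (Fin 4) k :=
  aeval (fun i => ∑ j, C (M i j) * X j) F

/-- The ten quadratic forms corresponding to the symmetric matrices in the
image of `H₂` in `PGL₄`. -/
def heisQuads (k : Type*) [Field k] : Fin 10 → MvPolynomial (Fin 4) k :=
  ![X 0 ^ 2 + X 1 ^ 2 + X 2 ^ 2 + X 3 ^ 2,
    X 0 ^ 2 - X 1 ^ 2 + X 2 ^ 2 - X 3 ^ 2,
    X 0 ^ 2 + X 1 ^ 2 - X 2 ^ 2 - X 3 ^ 2,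
    X 0 ^ 2 - X 1 ^ 2 - X 2 ^ 2 + X 3 ^ 2,
    X 0 * X 1 + X 2 * X 3, X 0 * X 1 - X 2 * X 3,
    X 0 * X 2 + X 1 * X 3, X 0 * X 2 - X 1 * X 3,
    X 0 * X 3 + X 1 * X 2, X 0 * X 3 - X 1 * X 2]


/-- The quadratic form with given coefficients. -/
def qform {k : Type*} [Field k] (a : Fin 10 → k) : MvPolynomial (Fin 4) k :=
  C (a 0) * X 0 ^ 2 + C (a 1) * X 1 ^ 2 + C (a 2) * X 2 ^ 2 + C (a 3) * X 3 ^ 2 +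
  C (a 4) * (X 0 * X 1) + C (a 5) * (X 2 * X 3) + C (a 6) * (X 0 * X 2) + C (a 7) * (X 1 * X 3) +
  C (a 8) * (X 0 * X 3) + C (a 9) * (X 1 * X 2)

lemma qform_add {k : Type*} [Field k] (a b : Fin 10 → k) : qform (a + b) = qform a + qform b := by
  simp only [qform, Pi.add_apply, map_add]; ring

lemma qform_smul {k : Type*} [Field k] (c : k) (a : Fin 10 → k) :
    qform (c • a) = C c * qform a := by
  simp only [qform, Pi.smul_apply, smul_eq_mul, map_mul]; ring

lemma qform_inj {k : Type*} [Field k] {a b : Fin 10 → k} (h : qform a = qform b) : a = b := by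
  have key : ∀ v : Fin 4 → k, eval v (qform a) = eval v (qform b) := fun v => by rw [h]
  simp only [qform, map_add, map_mul, map_pow, eval_C, eval_X] at key
  have h0 := key ![1, 0, 0, 0]
  have h1 := key ![0, 1, 0, 0]
  have h2 := key ![0, 0, 1, 0]
  have h3 := key ![0, 0, 0, 1]
  have h4 := key ![1, 1, 0, 0]
  have h5 := key ![0, 0, 1, 1]
  have h6 := key ![1, 0, 1, 0]
  have h7 := key ![0, 1, 0, 1]
  have h8 := key ![1, 0, 0, 1]
  have h9 := key ![0, 1, 1, 0]
  clear key h
  simp at h0 h1 h2 h3 h4 h5 h6 h7 h8 h9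
  funext i
  fin_cases i <;> simp <;> grind

lemma exists_qform_monomial {k : Type*} [Field k] (d : Fin 4 →₀ ℕ) (c : k) (hd : d.degree = 2) :
    ∃ a, monomial d c = qform a := by
  have hs : d 0 + d 1 + d 2 + d 3 = 2 := by
    rw [← hd, Finsupp.degree_eq_sum, Fin.sum_univ_four]
  have hm : monomial d c = C c * (X 0 ^ d 0 * X 1 ^ d 1 * X 2 ^ d 2 * X 3 ^ d 3) := by
    rw [monomial_eq, Finsupp.prod_fintype _ _ (by simp), Fin.prod_univ_four]
  rw [hm]
  generalize d 0 = p at *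
  generalize d 1 = q at *
  generalize d 2 = r at *
  generalize d 3 = s at *
  clear hm hd
  have hp : p ≤ 2 := by omega
  have hq : q ≤ 2 := by omega
  have hr : r ≤ 2 := by omega
  obtain rfl : s = 2 - p - q - r := by omega
  have e : ∀ i : Fin 10, (qform (Pi.single i c) : MvPolynomial (Fin 4) k) =
      C c * ![X 0 ^ 2, X 1 ^ 2, X 2 ^ 2, X 3 ^ 2, X 0 * X 1, X 2 * X 3, X 0 * X 2, X 1 * X 3,
        X 0 * X 3, X 1 * X 2] i := by
    intro i
    fin_cases i <;> simp [qform]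
  interval_cases p <;> interval_cases q <;> interval_cases r <;> first
    | omega
    | (refine ⟨_, Eq.trans ?_ (e 0).symm⟩; simp; done)
    | (refine ⟨_, Eq.trans ?_ (e 1).symm⟩; simp; done)
    | (refine ⟨_, Eq.trans ?_ (e 2).symm⟩; simp; done)
    | (refine ⟨_, Eq.trans ?_ (e 3).symm⟩; simp; done)
    | (refine ⟨_, Eq.trans ?_ (e 4).symm⟩; simp; done)
    | (refine ⟨_, Eq.trans ?_ (e 5).symm⟩; simp; done)
    | (refine ⟨_, Eq.trans ?_ (e 6).symm⟩; simp; done)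
    | (refine ⟨_, Eq.trans ?_ (e 7).symm⟩; simp; done)
    | (refine ⟨_, Eq.trans ?_ (e 8).symm⟩; simp; done)
    | (refine ⟨_, Eq.trans ?_ (e 9).symm⟩; simp; done)

lemma exists_qform {k : Type*} [Field k] (Q : MvPolynomial (Fin 4) k) (hQ : Q.IsHomogeneous 2) :
    ∃ a, Q = qform a := by
  have hd : ∀ d ∈ Q.support, ∃ a, monomial d (coeff d Q) = qform a := fun d hd =>
    exists_qform_monomial d _ (by
      have := hQ (mem_support_iff.1 hd)
      rw [Finsupp.degree_eq_weight_one]; exact this)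
  rw [Q.as_sum]
  refine Finset.sum_induction _ (fun P => ∃ a, P = qform a) ?_ ⟨0, by simp [qform]⟩ hd
  rintro _ _ ⟨a, rfl⟩ ⟨b, rfl⟩
  exact ⟨a + b, (qform_add a b).symm⟩

lemma matAct_one {k : Type*} [Field k] (F : MvPolynomial (Fin 4) k) : matAct 1 F = F := by
  have : (fun i : Fin 4 => ∑ j, C ((1 : Matrix (Fin 4) (Fin 4) k) i j) * X j) = X := by
    funext i
    simp [Matrix.one_apply]
  rw [matAct, this]; simp

lemma matAct_mul {k : Type*} [Field k] (M N : Matrix (Fin 4) (Fin 4) k)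
    (F : MvPolynomial (Fin 4) k) : matAct (M * N) F = matAct N (matAct M F) := by
  have h : (aeval (fun i => ∑ j, C ((M * N) i j) * X j) :
      MvPolynomial (Fin 4) k →ₐ[k] MvPolynomial (Fin 4) k) =
      (aeval (fun i => ∑ j, C (N i j) * X j)).comp (aeval (fun i => ∑ j, C (M i j) * X j)) := by
    refine MvPolynomial.algHom_ext fun i => ?_
    rw [AlgHom.comp_apply, aeval_X, aeval_X]
    simp only [Matrix.mul_apply, Fin.sum_univ_four, map_add, map_mul, aeval_X, algHom_C,
      MvPolynomial.algebraMap_eq]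
    ring
  exact DFunLike.congr_fun h F

lemma matAct_pow {k : Type*} [Field k] (M : Matrix (Fin 4) (Fin 4) k)
    (F : MvPolynomial (Fin 4) k) (n : ℕ) : matAct M (F ^ n) = matAct M F ^ n := by
  simp [matAct]

lemma matAct_C_mul {k : Type*} [Field k] (M : Matrix (Fin 4) (Fin 4) k)
    (F : MvPolynomial (Fin 4) k) (c : k) : matAct M (C c * F) = C c * matAct M F := by
  simp [matAct]

lemma matAct_A {k : Type*} [Field k] (a : Fin 10 → k) :
    matAct (Matrix.diagonal ![1, -1, 1, -1]) (qform a) =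
      qform ![a 0, a 1, a 2, a 3, -a 4, -a 5, a 6, a 7, -a 8, -a 9] := by
  simp [matAct, qform, Fin.sum_univ_four, Matrix.diagonal_apply]

lemma matAct_B {k : Type*} [Field k] (a : Fin 10 → k) :
    matAct (Matrix.diagonal ![1, 1, -1, -1]) (qform a) =
      qform ![a 0, a 1, a 2, a 3, a 4, a 5, -a 6, -a 7, -a 8, -a 9] := by
  simp [matAct, qform, Fin.sum_univ_four, Matrix.diagonal_apply]

lemma matAct_S {k : Type*} [Field k] (a : Fin 10 → k) :
    matAct !![0, 1, 0, 0; 1, 0, 0, 0; 0, 0, 0, 1; 0, 0, 1, 0] (qform a) =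
      qform ![a 1, a 0, a 3, a 2, a 4, a 5, a 7, a 6, a 9, a 8] := by
  simp [matAct, qform, Fin.sum_univ_four]
  ring

lemma matAct_T {k : Type*} [Field k] (a : Fin 10 → k) :
    matAct !![0, 0, 1, 0; 0, 0, 0, 1; 1, 0, 0, 0; 0, 1, 0, 0] (qform a) =
      qform ![a 2, a 3, a 0, a 1, a 5, a 4, a 6, a 7, a 9, a 8] := by
  simp [matAct, qform, Fin.sum_univ_four]
  ring

/-- Coefficients of the ten quadratic forms. -/
def heisTab (k : Type*) [Field k] : Fin 10 → Fin 10 → k :=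
  ![![1, 1, 1, 1, 0, 0, 0, 0, 0, 0],
    ![1, -1, 1, -1, 0, 0, 0, 0, 0, 0],
    ![1, 1, -1, -1, 0, 0, 0, 0, 0, 0],
    ![1, -1, -1, 1, 0, 0, 0, 0, 0, 0],
    ![0, 0, 0, 0, 1, 1, 0, 0, 0, 0],
    ![0, 0, 0, 0, 1, -1, 0, 0, 0, 0],
    ![0, 0, 0, 0, 0, 0, 1, 1, 0, 0],
    ![0, 0, 0, 0, 0, 0, 1, -1, 0, 0],
    ![0, 0, 0, 0, 0, 0, 0, 0, 1, 1],
    ![0, 0, 0, 0, 0, 0, 0, 0, 1, -1]]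

lemma heisQuads_eq {k : Type*} [Field k] (i : Fin 10) : heisQuads k i = qform (heisTab k i) := by
  fin_cases i <;> simp [heisQuads, heisTab, qform] <;> ring

lemma sq_eq_smul {k : Type*} [Field k] {a b : Fin 10 → k} {d : k}
    (h : qform a ^ 2 = (C d * qform b) ^ 2) : ∃ e : k, e ^ 2 = d ^ 2 ∧ a = e • b := by
  rcases sq_eq_sq_iff_eq_or_eq_neg.1 h with h | h
  · exact ⟨d, rfl, qform_inj (by rw [h, qform_smul])⟩
  · exact ⟨-d, by ring, qform_inj (by rw [h, qform_smul]; simp)⟩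

lemma sign_of_inv {k : Type*} [Field k] {a b : Fin 10 → k}
    (h : qform b ^ 2 = qform a ^ 2) : (∀ i, b i = a i) ∨ (∀ i, b i = - a i) := by
  obtain ⟨e, he, rfl⟩ := sq_eq_smul (d := 1) (a := b) (b := a) (by simpa using h)
  rcases sq_eq_sq_iff_eq_or_eq_neg.1 he with rfl | rfl
  · left; simp
  · right; simp

set_option maxHeartbeats 4000000 in
lemma classify {k : Type*} [Field k] (h2 : (2 : k) ≠ 0) (a : Fin 10 → k)
    (h : ∀ M ∈ heisGens k, matAct M (qform a) ^ 2 = qform a ^ 2) :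
    ∃ (c : k) (i : Fin 10), a = c • heisTab k i := by
  have hA := h _ (Or.inl rfl)
  have hB := h _ (Or.inr (Or.inl rfl))
  have hS := h _ (Or.inr (Or.inr (Or.inl rfl)))
  have hT := h _ (Or.inr (Or.inr (Or.inr rfl)))
  clear h
  rw [matAct_A] at hA
  rw [matAct_B] at hB
  rw [matAct_S] at hS
  rw [matAct_T] at hT
  have z : ∀ x : k, -x = x → x = 0 := fun x hx => by grind
  have z' : ∀ x : k, x = -x → x = 0 := fun x hx => by grind
  have ext10 : ∀ b : Fin 10 → k, a 0 = b 0 → a 1 = b 1 → a 2 = b 2 → a 3 = b 3 → a 4 = b 4 →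
      a 5 = b 5 → a 6 = b 6 → a 7 = b 7 → a 8 = b 8 → a 9 = b 9 → a = b := by
    intros; funext i; fin_cases i <;> assumption
  have hA := sign_of_inv hA
  have hB := sign_of_inv hB
  have hS := sign_of_inv hS
  have hT := sign_of_inv hT
  simp only [Fin.forall_fin_succ, IsEmpty.forall_iff] at hA hB hS hT
  simp at hA hB hS hT
  have fin : ∀ (c : k) (i : Fin 10), (a 0 = c * heisTab k i 0 ∧ a 1 = c * heisTab k i 1 ∧
      a 2 = c * heisTab k i 2 ∧ a 3 = c * heisTab k i 3 ∧ a 4 = c * heisTab k i 4 ∧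
      a 5 = c * heisTab k i 5 ∧ a 6 = c * heisTab k i 6 ∧ a 7 = c * heisTab k i 7 ∧
      a 8 = c * heisTab k i 8 ∧ a 9 = c * heisTab k i 9) →
      ∃ (c : k) (i : Fin 10), a = c • heisTab k i := by
    rintro c i ⟨h0, h1, h2, h3, h4, h5, h6, h7, h8, h9⟩
    exact ⟨c, i, ext10 _ h0 h1 h2 h3 h4 h5 h6 h7 h8 h9⟩
  clear ext10
  generalize a 0 = a0 at *
  generalize a 1 = a1 at *
  generalize a 2 = a2 at *
  generalize a 3 = a3 at *
  generalize a 4 = a4 at *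
  generalize a 5 = a5 at *
  generalize a 6 = a6 at *
  generalize a 7 = a7 at *
  generalize a 8 = a8 at *
  generalize a 9 = a9 at *
  rcases hA with hA | hA <;> rcases hB with hB | hB <;> rcases hS with hS | hS <;>
    rcases hT with hT | hT
  · apply fin a0 0; clear fin; simp [heisTab]; grind
  · apply fin a0 2; clear fin; simp [heisTab]; grind
  · apply fin a0 1; clear fin; simp [heisTab]; grind
  · apply fin a0 3; clear fin; simp [heisTab]; grind
  · apply fin a6 6; clear fin; simp [heisTab]; grind
  · apply fin a6 6; clear fin; simp [heisTab]; grind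
  · apply fin a6 7; clear fin; simp [heisTab]; grind
  · apply fin a6 7; clear fin; simp [heisTab]; grind
  · apply fin a4 4; clear fin; simp [heisTab]; grind
  · apply fin a4 5; clear fin; simp [heisTab]; grind
  · apply fin a4 4; clear fin; simp [heisTab]; grind
  · apply fin a4 5; clear fin; simp [heisTab]; grind
  · apply fin a8 8; clear fin; simp [heisTab]; grind
  · apply fin a8 8; clear fin; simp [heisTab]; grind
  · apply fin a8 9; clear fin; simp [heisTab]; grind
  · apply fin a8 9; clear fin; simp [heisTab]; grind

set_option maxHeartbeats 4000000 in
lemma tab_inj {k : Type*} [Field k] (h2 : (2 : k) ≠ 0) (i j : Fin 10) (e : k)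
    (h : heisTab k i = e • heisTab k j) : i = j := by
  have h := congrFun h
  simp only [Fin.forall_fin_succ, IsEmpty.forall_iff] at h
  fin_cases i <;> fin_cases j <;> first | rfl | (exfalso; simp [heisTab] at h; try grind)

lemma sq_of_sign {k : Type*} [Field k] {a b : Fin 10 → k} (h : b = a ∨ b = -a) :
    qform b ^ 2 = qform a ^ 2 := by
  rcases h with rfl | rfl
  · rfl
  · have : qform (-a) = -qform a := by
      simp only [qform, Pi.neg_apply, map_neg]; ring
    rw [this, neg_sq]

set_option maxHeartbeats 4000000 in
lemma tab_inv {k : Type*} [Field k] (i : Fin 10) (M : Matrix (Fin 4) (Fin 4) k)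
    (hM : M ∈ heisGens k) : matAct M (qform (heisTab k i)) ^ 2 = qform (heisTab k i) ^ 2 := by
  rcases hM with rfl | rfl | rfl | rfl
  · rw [matAct_A]
    refine sq_of_sign ?_
    fin_cases i <;> simp [heisTab]
  · rw [matAct_B]
    refine sq_of_sign ?_
    fin_cases i <;> simp [heisTab]
  · rw [matAct_S]
    refine sq_of_sign ?_
    fin_cases i <;> simp [heisTab]
  · rw [matAct_T]
    refine sq_of_sign ?_
    fin_cases i <;> simp [heisTab]

lemma qform_hom {k : Type*} [Field k] (a : Fin 10 → k) : (qform a).IsHomogeneous 2 := by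
  have h1 : ∀ (c : k) (i : Fin 4), (C c * X i ^ 2 : MvPolynomial (Fin 4) k).IsHomogeneous 2 :=
    fun c i => by
      simpa using (isHomogeneous_C (Fin 4) c).mul ((isHomogeneous_X k i).pow 2)
  have h2 : ∀ (c : k) (i j : Fin 4), (C c * (X i * X j) : MvPolynomial (Fin 4) k).IsHomogeneous 2 :=
    fun c i j => by
      simpa using (isHomogeneous_C (Fin 4) c).mul ((isHomogeneous_X k i).mul (isHomogeneous_X k j))
  unfold qform
  exact (((((((((h1 _ _).add (h1 _ _)).add (h1 _ _)).add (h1 _ _)).add (h2 _ _ _)).add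
    (h2 _ _ _)).add (h2 _ _ _)).add (h2 _ _ _)).add (h2 _ _ _)).add (h2 _ _ _)

lemma tab_ne_zero {k : Type*} [Field k] (i : Fin 10) : qform (heisTab k i) ≠ 0 := by
  intro h
  have h0 : heisTab k i = 0 := qform_inj (h.trans (by simp [qform]))
  have h := congrFun h0
  simp only [Fin.forall_fin_succ, IsEmpty.forall_iff] at h
  fin_cases i <;> simp [heisTab] at h

/-- Lemma 3.9 (second part): up to scalars there are exactly `10` nonzero
Heisenberg-invariant quartics that factor as the square of a quadratic form,
namely the squares of the ten quadratic forms corresponding to the symmetric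
matrices in the image of `H₂` in `PGL₄`. -/
theorem stmt_14 (k : Type*) [Field k] [IsAlgClosed k] (h2 : (2 : k) ≠ 0) :
    (∀ F : MvPolynomial (Fin 4) k,
      (F ≠ 0 ∧ F.IsHomogeneous 4 ∧
          (∀ M ∈ Submonoid.closure (heisGens k), matAct M F = F) ∧
          ∃ Q : MvPolynomial (Fin 4) k, Q.IsHomogeneous 2 ∧ F = Q ^ 2) ↔
        ∃ c : k, c ≠ 0 ∧ ∃ i : Fin 10, F = C c * heisQuads k i ^ 2) ∧
    ∀ i j : Fin 10,
      (∃ c : k, c ≠ 0 ∧ heisQuads k i ^ 2 = C c * heisQuads k j ^ 2) → i = j := by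
  refine ⟨fun F => ⟨?_, ?_⟩, ?_⟩
  · rintro ⟨hF, -, hinv, Q, hQ, rfl⟩
    obtain ⟨a, rfl⟩ := exists_qform Q hQ
    obtain ⟨c, i, rfl⟩ := classify h2 a fun M hM => by
      rw [← matAct_pow]; exact hinv M (Submonoid.subset_closure hM)
    refine ⟨c ^ 2, ?_, i, ?_⟩
    · rintro hc
      apply hF
      rw [qform_smul, mul_pow, ← map_pow, hc]; simp
    · rw [qform_smul, mul_pow, ← map_pow, heisQuads_eq]
  · rintro ⟨c, hc, i, rfl⟩
    obtain ⟨d, rfl⟩ := IsAlgClosed.exists_pow_nat_eq c (n := 2) (by norm_num)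
    rw [heisQuads_eq]
    have e : C (d ^ 2) * qform (heisTab k i) ^ 2 = qform (d • heisTab k i) ^ 2 := by
      rw [qform_smul, mul_pow, map_pow]
    refine ⟨mul_ne_zero (by simpa using hc) (pow_ne_zero _ (tab_ne_zero i)), ?_, ?_,
      qform (d • heisTab k i), qform_hom _, e⟩
    · rw [e]; exact (qform_hom _).pow 2
    · intro M hM
      induction hM using Submonoid.closure_induction with
      | mem M hM => rw [matAct_C_mul, matAct_pow, tab_inv i M hM]
      | one => exact matAct_one _
      | mul M N _ _ h1 h2 => rw [matAct_mul, h1, h2]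
  · rintro i j ⟨c, hc, h⟩
    obtain ⟨d, rfl⟩ := IsAlgClosed.exists_pow_nat_eq c (n := 2) (by norm_num)
    rw [heisQuads_eq, heisQuads_eq, map_pow, ← mul_pow] at h
    obtain ⟨e, -, h⟩ := sq_eq_smul h
    exact tab_inj h2 i j e h
end
end

section
/- Let k be a field of characteristic ≠ 2, let f(x) = f₆x⁶+f₅x⁵+f₄x⁴+f₃x³+f₂x²+f₁x+f₀ ∈ k[x] be separable of degree 6 with f₆ ≠ 0, and let L = k[x]/(f) = k[θ]. Let (G, H) be a model: G = u₀u₅+u₁u₄+u₂u₃ with 6×6 symmetric matrix 𝐆, and 𝐇 a 6×6 symmetric matrix over k such that det(x𝐆 − 𝐇) = −f₆^{−1}f(x). Define quadratic forms Q_j(u₀,…,u₅) = f₆^{−1} Σ_{i=j+1}^{6} fᵢ·𝐮ᵀ𝐆(𝐆^{−1}𝐇)^{i−j−1}𝐮 for 0 ≤ j ≤ 5, set Ξ = Σ_{j=0}^{5} Q_j θ^j ∈ L[u₀,…,u₅], and let M = 2^{−6}·det(∂Qᵢ/∂uⱼ) ∈ k[u₀,…,u₅]. Then N(Ξ) = M²,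 where N denotes the norm from L[u₀,…,u₅] to k[u₀,…,u₅] (the determinant of multiplication with respect to the basis 1, θ, …, θ⁵). -/
open Polynomial Matrix


lemma aux_G {k : Type*} [Field k] (h2 : (2 : k) ≠ 0)
    (MG : Matrix (Fin 6) (Fin 6) k) (hs : MG.IsSymm)
    (hMG : ∀ u : Fin 6 → k,
      u 0 * u 5 + u 1 * u 4 + u 2 * u 3 = (1 / 2) * (u ⬝ᵥ (MG *ᵥ u))) :
    MG = !![0,0,0,0,0,1; 0,0,0,0,1,0; 0,0,0,1,0,0; 0,0,1,0,0,0; 0,1,0,0,0,0; 1,0,0,0,0,0] := by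
  have key : ∀ i j : Fin 6, MG i j =
      (fun u v : Fin 6 → k => u 0 * v 5 + v 0 * u 5 + u 1 * v 4 + v 1 * u 4 + u 2 * v 3 + v 2 * u 3)
        (Pi.single i 1) (Pi.single j 1) := by
    intro i j
    have h1 := hMG (Pi.single i 1)
    have h3 := hMG (Pi.single j 1)
    have h4 := hMG (Pi.single i 1 + Pi.single j 1)
    simp only [Matrix.mulVec_add, dotProduct_add, add_dotProduct, Matrix.mulVec_single_one,
      single_one_dotProduct, Matrix.col_apply, Pi.add_apply] at h1 h3 h4
    have h5 : MG j i = MG i j := hs.apply i j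
    rw [h5] at h4
    have h6 : (1 / 2 : k) * 2 = 1 := by field_simp
    linear_combination -(h4 - h1 - h3) - MG i j * h6
  ext i j
  rw [key]
  fin_cases i <;> fin_cases j <;> simp [Pi.single_apply]

lemma aux_icc {R : Type*} [CommRing R] (g : ℕ → ℕ → R) (j : Fin 6) :
    ∑ i ∈ Finset.Icc ((j : ℕ) + 1) 6, g j i =
      (![g 0 1 + g 0 2 + g 0 3 + g 0 4 + g 0 5 + g 0 6, g 1 2 + g 1 3 + g 1 4 + g 1 5 + g 1 6,
        g 2 3 + g 2 4 + g 2 5 + g 2 6, g 3 4 + g 3 5 + g 3 6, g 4 5 + g 4 6, g 5 6] :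
        Fin 6 → R) j := by
  have h0 : Finset.Icc 1 6 = {1,2,3,4,5,6} := rfl
  have h1 : Finset.Icc 2 6 = {2,3,4,5,6} := rfl
  have h2 : Finset.Icc 3 6 = {3,4,5,6} := rfl
  have h3 : Finset.Icc 4 6 = {4,5,6} := rfl
  have h4 : Finset.Icc 5 6 = {5,6} := rfl
  have h5 : Finset.Icc 6 6 = {6} := rfl
  fin_cases j <;> simp [h0, h1, h2, h3, h4, h5, add_assoc]

lemma aux_det {R : Type*} [CommRing R] :
    (!![0,0,0,0,0,1; 0,0,0,0,1,0; 0,0,0,1,0,0; 0,0,1,0,0,0; 0,1,0,0,0,0; 1,0,0,0,0,0] :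
      Matrix (Fin 6) (Fin 6) R).det = -1 := by
  simp [Matrix.det_succ_row_zero, Fin.sum_univ_succ, Fin.succAbove]
  try ring

lemma aux_detB {R : Type*} [CommRing R] (p : ℕ → R) :
    (!![p 1,p 2,p 3,p 4,p 5,1; p 2,p 3,p 4,p 5,1,0; p 3,p 4,p 5,1,0,0; p 4,p 5,1,0,0,0;
      p 5,1,0,0,0,0; 1,0,0,0,0,0] : Matrix (Fin 6) (Fin 6) R).det = -1 := by
  have hT : (!![1,p 5,p 4,p 3,p 2,p 1; 0,1,p 5,p 4,p 3,p 2; 0,0,1,p 5,p 4,p 3; 0,0,0,1,p 5,p 4;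
      0,0,0,0,1,p 5; 0,0,0,0,0,1] : Matrix (Fin 6) (Fin 6) R).det = 1 := by
    rw [Matrix.det_of_upperTriangular]
    · simp [Fin.prod_univ_succ]
    · intro i j hij
      fin_cases i <;> fin_cases j <;> first | rfl | (exfalso; revert hij; decide)
  have h := Matrix.det_mul (!![1,p 5,p 4,p 3,p 2,p 1; 0,1,p 5,p 4,p 3,p 2; 0,0,1,p 5,p 4,p 3;
    0,0,0,1,p 5,p 4; 0,0,0,0,1,p 5; 0,0,0,0,0,1] : Matrix (Fin 6) (Fin 6) R)
    !![0,0,0,0,0,1; 0,0,0,0,1,0; 0,0,0,1,0,0; 0,0,1,0,0,0; 0,1,0,0,0,0; 1,0,0,0,0,0]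
  rw [hT, aux_det, one_mul] at h
  rw [← h]
  congr 1
  ext i j
  fin_cases i <;> fin_cases j <;> simp [Matrix.mul_apply, Fin.sum_univ_succ]

lemma aux_indep {k : Type*} [Field k] (f : k[X]) (hdeg : f.degree = 6)
    (a b : Fin 6 → MvPolynomial (Fin 6) k)
    (h : ∑ i : Fin 6, MvPolynomial.map (algebraMap k (AdjoinRoot f)) (a i)
            * MvPolynomial.C (AdjoinRoot.root f ^ (i : ℕ)) =
         ∑ i : Fin 6, MvPolynomial.map (algebraMap k (AdjoinRoot f)) (b i)
            * MvPolynomial.C (AdjoinRoot.root f ^ (i : ℕ))) : a = b := by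
  have hf : f ≠ 0 := by rintro rfl; simp at hdeg
  have hd : (AdjoinRoot.powerBasis hf).dim = 6 := by
    rw [AdjoinRoot.powerBasis_dim]; exact natDegree_eq_of_degree_eq_some hdeg
  have hli : LinearIndependent k (fun i : Fin 6 => AdjoinRoot.root f ^ (i : ℕ)) := by
    have := (AdjoinRoot.powerBasis hf).basis.linearIndependent
    rw [PowerBasis.coe_basis, AdjoinRoot.powerBasis_gen] at this
    exact this.comp (Fin.cast hd.symm) (Fin.cast_injective _)
  rw [Fintype.linearIndependent_iff] at hli
  funext i
  ext m
  have := hli (fun i => (a i).coeff m - (b i).coeff m) (by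
    have := congrArg (MvPolynomial.coeff m) h
    simp only [mul_comm _ (MvPolynomial.C _)] at this
    simp only [MvPolynomial.coeff_sum, MvPolynomial.coeff_C_mul, MvPolynomial.coeff_map] at this
    simp only [mul_comm (AdjoinRoot.root f ^ _)] at this
    simp only [Algebra.smul_def, map_sub, sub_mul, Finset.sum_sub_distrib, this, sub_self]) i
  exact sub_eq_zero.mp this

lemma aux_step {S : Type*} [CommRing S] (p s : ℕ → S) (th : S) (n : ℕ) (h6 : p 6 = 1)
    (hp : ∑ i ∈ Finset.range 7, p i * th ^ i = 0)
    (hs : ∑ i ∈ Finset.range 7, p i * s (n + i) = 0) :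
    (∑ j : Fin 6, (∑ i ∈ Finset.Icc ((j : ℕ) + 1) 6, p i * s (i - (j : ℕ) - 1 + n)) * th ^ (j : ℕ))
      * th =
    ∑ j : Fin 6, (∑ i ∈ Finset.Icc ((j : ℕ) + 1) 6, p i * s (i - (j : ℕ) - 1 + (n + 1)))
      * th ^ (j : ℕ) := by
  have e1 : ∀ j : Fin 6, _ := aux_icc (fun j i => p i * s (i - j - 1 + n))
  have e2 : ∀ j : Fin 6, _ := aux_icc (fun j i => p i * s (i - j - 1 + (n + 1)))
  simp only [e1, e2]
  clear e1 e2
  simp [Fin.sum_univ_six, Finset.sum_range_succ, h6, ← add_assoc, add_comm _ n] at hp hs ⊢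
  linear_combination (s n) * hp - hs

set_option maxHeartbeats 4000000 in
/-- Lemma 2.11: for a model `(G, H)` with associated quadratic forms
`Q₀,…,Q₅`, the forms `Ξ = Σ Q_j θ^j` and `M = 2⁻⁶ det(∂Q_i/∂u_j)` satisfy
`N(Ξ) = M²`, where `N` is the norm from `L[u₀,…,u₅]` to `k[u₀,…,u₅]`,
computed as the determinant of the multiplication-by-`Ξ` matrix with respect
to the basis `1, θ, …, θ⁵` of `L = k[x]/(f)`. -/
theorem stmt_17 (k : Type*) [Field k] (h2 : (2 : k) ≠ 0)
    (f : k[X]) (hdeg : f.degree = 6) (hsep : f.Separable)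
    (MG MH : Matrix (Fin 6) (Fin 6) k)
    (hMGsymm : MG.IsSymm) (hMHsymm : MH.IsSymm)
    (hMG : ∀ u : Fin 6 → k,
      u 0 * u 5 + u 1 * u 4 + u 2 * u 3 = (1 / 2) * (u ⬝ᵥ (MG *ᵥ u)))
    (hdet : Matrix.det ((X : k[X]) • MG.map C - MH.map C)
      = -C f.leadingCoeff⁻¹ * f)
    (Q : Fin 6 → MvPolynomial (Fin 6) k)
    (hQ : ∀ j : Fin 6, Q j = MvPolynomial.C f.leadingCoeff⁻¹ *
      ∑ i ∈ Finset.Icc ((j : ℕ) + 1) 6, MvPolynomial.C (f.coeff i) *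
        ∑ s : Fin 6, ∑ t : Fin 6,
          MvPolynomial.C ((MG * (MG⁻¹ * MH) ^ (i - (j : ℕ) - 1)) s t)
            * MvPolynomial.X s * MvPolynomial.X t)
    (M : MvPolynomial (Fin 6) k)
    (hM : M = MvPolynomial.C (((2 : k) ^ 6)⁻¹) *
      Matrix.det (Matrix.of fun i j : Fin 6 => MvPolynomial.pderiv j (Q i)))
    (Nmat : Matrix (Fin 6) (Fin 6) (MvPolynomial (Fin 6) k))
    (hN : ∀ j : Fin 6,
      (∑ j' : Fin 6, MvPolynomial.map (algebraMap k (AdjoinRoot f)) (Q j')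
          * MvPolynomial.C (AdjoinRoot.root f ^ ((j' : ℕ))))
          * MvPolynomial.C (AdjoinRoot.root f ^ (j : ℕ))
        = ∑ i : Fin 6, MvPolynomial.map (algebraMap k (AdjoinRoot f)) (Nmat i j)
            * MvPolynomial.C (AdjoinRoot.root f ^ (i : ℕ))) :
    Nmat.det = M ^ 2 := by
  have hG := aux_G h2 MG hMGsymm hMG
  have hGdet : MG.det = -1 := by rw [hG]; exact aux_det
  have hGG : MG * MG = 1 := by
    rw [hG]; ext i j; fin_cases i <;> fin_cases j <;>
      simp [Matrix.mul_apply, Fin.sum_univ_succ]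
  have hGinv : MG⁻¹ = MG := Matrix.inv_eq_right_inv hGG
  rw [hGinv] at hQ
  set A := MG * MH with hA
  have hlc : f.leadingCoeff ≠ 0 := by
    rw [leadingCoeff_ne_zero]; rintro rfl; simp at hdeg
  have hnd : f.natDegree = 6 := natDegree_eq_of_degree_eq_some hdeg
  have hGA : MG * A = MH := by rw [hA, ← Matrix.mul_assoc, hGG, Matrix.one_mul]
  have hchar : A.charpoly = C f.leadingCoeff⁻¹ * f := by
    have h1 : (X : k[X]) • MG.map C - MH.map C = MG.map C * A.charmatrix := by
      rw [Matrix.charmatrix, Matrix.mul_sub, ← hGA]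
      simp [Matrix.map_mul, Matrix.scalar_apply]
      ext1 a b
      rw [Matrix.mul_diagonal, Matrix.smul_apply, smul_eq_mul, mul_comm]
    have h3 : (MG.map (C : k →+* k[X])).det = C MG.det := (RingHom.map_det C MG).symm
    rw [h1, Matrix.det_mul, h3, hGdet] at hdet
    simp only [map_neg, map_one, neg_mul, one_mul, neg_inj] at hdet
    exact hdet
  have hCH : ∑ i ∈ Finset.range 7, (f.leadingCoeff⁻¹ * f.coeff i) • A ^ i = 0 := by
    have h1 := A.aeval_self_charpoly
    rw [hchar, Polynomial.aeval_eq_sum_range' (n := 7)] at h1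
    · simpa only [coeff_C_mul] using h1
    · rw [natDegree_C_mul (inv_ne_zero hlc)]; omega
  set x : Fin 6 → MvPolynomial (Fin 6) k := MvPolynomial.X with hx
  let W : ℕ → Matrix (Fin 6) (Fin 6) (MvPolynomial (Fin 6) k) :=
    fun n => (MG * A ^ n).map MvPolynomial.C
  have hWsymm : ∀ n s t, (MG * A ^ n) s t = (MG * A ^ n) t s := by
    intro n s t
    have h1 : SemiconjBy MG A Aᵀ := by
      unfold SemiconjBy
      rw [hGA, hA, Matrix.transpose_mul, hMGsymm.eq, hMHsymm.eq, Matrix.mul_assoc, hGG,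
        Matrix.mul_one]
    have h3 : (MG * A ^ n)ᵀ = MG * A ^ n := by
      rw [Matrix.transpose_mul, Matrix.transpose_pow, hMGsymm.eq, (h1.pow_right n).eq]
    conv_lhs => rw [← h3]
    rfl
  let s : ℕ → MvPolynomial (Fin 6) k := fun n => x ⬝ᵥ (W n *ᵥ x)
  let p : ℕ → MvPolynomial (Fin 6) k := fun i => MvPolynomial.C (f.leadingCoeff⁻¹ * f.coeff i)
  have hp6 : p 6 = 1 := by
    simp only [p]
    rw [← hnd, coeff_natDegree, inv_mul_cancel₀ hlc, map_one]
  have hs' : ∀ n, s n = ∑ a : Fin 6, ∑ b : Fin 6,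
      MvPolynomial.C ((MG * A ^ n) a b) * MvPolynomial.X a * MvPolynomial.X b := by
    intro n
    simp only [s, W, dotProduct, Matrix.mulVec, Finset.mul_sum, Matrix.map_apply, hx]
    refine Finset.sum_congr rfl fun a _ => Finset.sum_congr rfl fun b _ => by ring
  have hQ' : ∀ j : Fin 6, Q j = ∑ i ∈ Finset.Icc ((j : ℕ) + 1) 6, p i * s (i - (j : ℕ) - 1) := by
    intro j
    rw [hQ, Finset.mul_sum]
    refine Finset.sum_congr rfl fun i _ => ?_
    rw [hs', ← mul_assoc, ← map_mul]
  have hrec : ∀ n, ∑ i ∈ Finset.range 7, p i * s (n + i) = 0 := by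
    intro n
    have h1 : ∑ i ∈ Finset.range 7, p i • W (n + i) = 0 := by
      have h3 : ∑ i ∈ Finset.range 7,
          (f.leadingCoeff⁻¹ * f.coeff i) • (MG * A ^ (n + i)) = 0 := by
        have h4 := congrArg (fun Z => MG * A ^ n * Z) hCH
        simpa only [Finset.mul_sum, mul_zero, Matrix.mul_smul, Matrix.mul_assoc, ← pow_add]
          using h4
      ext1 a b
      have h4 := congrArg (MvPolynomial.C (σ := Fin 6)) (congrFun (congrFun h3 a) b)
      simp only [Matrix.sum_apply, Matrix.smul_apply, smul_eq_mul, map_sum, map_mul,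
        Matrix.zero_apply, map_zero] at h4
      simpa only [Matrix.sum_apply, Matrix.smul_apply, smul_eq_mul, p, W, Matrix.map_apply,
        map_mul, Matrix.zero_apply] using h4
    have h3 : ∑ i ∈ Finset.range 7, p i * s (n + i)
        = x ⬝ᵥ ((∑ i ∈ Finset.range 7, p i • W (n + i)) *ᵥ x) := by
      rw [Matrix.sum_mulVec, dotProduct_sum]
      simp only [Matrix.smul_mulVec, dotProduct_smul, smul_eq_mul, s]
    rw [h3, h1]; simp
  let B : Matrix (Fin 6) (Fin 6) (MvPolynomial (Fin 6) k) :=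
    !![p 1,p 2,p 3,p 4,p 5,1; p 2,p 3,p 4,p 5,1,0; p 3,p 4,p 5,1,0,0; p 4,p 5,1,0,0,0;
      p 5,1,0,0,0,0; 1,0,0,0,0,0]
  have hB : B.det = -1 := aux_detB p
  have hBsum : ∀ (g : ℕ → MvPolynomial (Fin 6) k) (j : Fin 6),
      ∑ i ∈ Finset.Icc ((j : ℕ) + 1) 6, p i * g (i - (j : ℕ) - 1) = ∑ m : Fin 6, B j m * g m := by
    intro g j
    rw [aux_icc (fun j i => p i * g (i - j - 1)) j]
    fin_cases j <;> simp [B, Fin.sum_univ_six, hp6]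
  let K : Matrix (Fin 6) (Fin 6) (MvPolynomial (Fin 6) k) :=
    Matrix.of fun n t => (W n *ᵥ x) t
  let S : Matrix (Fin 6) (Fin 6) (MvPolynomial (Fin 6) k) :=
    Matrix.of fun m n => s ((m : ℕ) + n)
  have hWt : ∀ n, (W n)ᵀ = W n := by
    intro n; ext1 a b; simp only [W, Matrix.transpose_apply, Matrix.map_apply]; rw [hWsymm]
  have hWW : ∀ m n, W m * (MG.map MvPolynomial.C * W n) = W (m + n) := by
    intro m n
    simp only [W]
    rw [← Matrix.map_mul, ← Matrix.map_mul, ← Matrix.mul_assoc MG MG, hGG, Matrix.one_mul,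
      Matrix.mul_assoc, ← pow_add]
  have hKS : K * MG.map MvPolynomial.C * Kᵀ = S := by
    ext1 m n
    have h1 : (K * (MG.map MvPolynomial.C : Matrix (Fin 6) (Fin 6) (MvPolynomial (Fin 6) k)) * Kᵀ) m n
        = (W m *ᵥ x) ⬝ᵥ (MG.map MvPolynomial.C *ᵥ (W n *ᵥ x)) := by
      rw [Matrix.mul_assoc]
      rfl
    rw [h1, ← hWt m, Matrix.mulVec_transpose, ← Matrix.dotProduct_mulVec, Matrix.mulVec_mulVec,
      Matrix.mulVec_mulVec, Matrix.mul_assoc, hWW]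
    rfl
  have hGdetC : (MG.map (MvPolynomial.C : k →+* MvPolynomial (Fin 6) k)).det = -1 := by
    have h3 : (MG.map (MvPolynomial.C : k →+* MvPolynomial (Fin 6) k)).det = MvPolynomial.C MG.det :=
      (RingHom.map_det MvPolynomial.C MG).symm
    rw [h3, hGdet, map_neg, map_one]
  have hSdet : S.det = - K.det ^ 2 := by
    rw [← hKS, Matrix.det_mul, Matrix.det_mul, Matrix.det_transpose, hGdetC]
    ring
  have hpd : ∀ n t, MvPolynomial.pderiv t (s n) = 2 * (W n *ᵥ x) t := by
    intro n t
    rw [hs']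
    simp only [map_sum, Derivation.leibniz, MvPolynomial.pderiv_C, MvPolynomial.pderiv_X,
      smul_eq_mul, mul_zero, add_zero, Pi.single_apply]
    simp only [mul_ite, mul_one, mul_zero, Finset.sum_add_distrib, Matrix.mulVec, dotProduct]
    simp [W, hx, two_mul, -Matrix.map_mul]
    congr 1
    · exact Finset.sum_congr rfl fun a _ => by rw [hWsymm]
    · exact Finset.sum_congr rfl fun a _ => mul_comm _ _
  have hJ : (Matrix.of fun i j : Fin 6 => MvPolynomial.pderiv j (Q i)) =
      (2 : MvPolynomial (Fin 6) k) • (B * K) := by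
    ext1 i j
    have h1 := hBsum (fun n => (W n *ᵥ x) j) i
    have h3 : (B * K) i j = ∑ m : Fin 6, B i m * (W m *ᵥ x) j := rfl
    rw [Matrix.of_apply, Matrix.smul_apply, h3, ← h1, hQ', map_sum, smul_eq_mul, Finset.mul_sum]
    refine Finset.sum_congr rfl fun l _ => ?_
    simp only [p, MvPolynomial.pderiv_C_mul, hpd]
    ring
  have hMdet : M = - K.det := by
    rw [hM, hJ, Matrix.det_smul, Matrix.det_mul, hB]
    have h1 : MvPolynomial.C (((2 : k) ^ 6)⁻¹) * (2 : MvPolynomial (Fin 6) k) ^ 6 = 1 := by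
      have : (2 : MvPolynomial (Fin 6) k) = MvPolynomial.C 2 := (map_ofNat MvPolynomial.C 2).symm
      rw [this, ← map_pow, ← map_mul, inv_mul_cancel₀ (pow_ne_zero _ h2), map_one]
    simp only [Fintype.card_fin]
    linear_combination (-K.det) * h1
  have hNBS : Nmat = B * S := by
    let φ := MvPolynomial.map (σ := Fin 6) (algebraMap k (AdjoinRoot f))
    let th : MvPolynomial (Fin 6) (AdjoinRoot f) := MvPolynomial.C (AdjoinRoot.root f)
    have hth : ∑ i ∈ Finset.range 7, φ (p i) * th ^ i = 0 := by
      have h1 := AdjoinRoot.aeval_eq (f := f) f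
      rw [AdjoinRoot.mk_self, Polynomial.aeval_eq_sum_range, hnd] at h1
      have h3 := congrArg (fun z => MvPolynomial.C (σ := Fin 6)
        (algebraMap k (AdjoinRoot f) f.leadingCoeff⁻¹ * z)) h1
      simp only [Algebra.smul_def, Finset.mul_sum, map_sum, mul_zero, map_zero] at h3
      rw [← h3]
      refine Finset.sum_congr rfl fun i _ => ?_
      simp only [φ, p, th, MvPolynomial.map_C, map_mul, map_pow, mul_assoc]
    have hpow : ∀ n : ℕ, (∑ j : Fin 6, φ (Q j) * th ^ (j : ℕ)) * th ^ n =
        ∑ j : Fin 6, (∑ i ∈ Finset.Icc ((j : ℕ) + 1) 6,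
          φ (p i) * φ (s (i - (j : ℕ) - 1 + n))) * th ^ (j : ℕ) := by
      intro n
      induction n with
      | zero => simp only [hQ', map_sum, map_mul, pow_zero, mul_one, add_zero]
      | succ n ih =>
        rw [pow_succ, ← mul_assoc, ih]
        refine aux_step (fun i => φ (p i)) (fun i => φ (s i)) th n (by simp [hp6]) hth ?_
        simpa using congrArg φ (hrec n)
    ext1 i j
    refine congrFun (aux_indep f hdeg (fun i => Nmat i j) (fun i => (B * S) i j) ?_) i
    rw [← hN j]
    have h1 := hpow j
    simp only [φ, th, ← map_pow] at h1
    rw [h1]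
    refine Finset.sum_congr rfl fun i _ => ?_
    rw [Matrix.mul_apply]
    have h3 := hBsum (fun n => s (n + j)) i
    simp only [S, Matrix.of_apply]
    rw [← h3]
    simp only [map_sum, map_mul]
  rw [hNBS, Matrix.det_mul, hB, hSdet, hMdet]
  ring
end
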